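/- arXiv:1109.2415 — 2 statements merged into one kernel-verified Lean document; each statement's English description precedes it below -/
import Mathlib

section
/- Let y ∈ E, e ∈ E, ε ≥ 0, and let x be an ε-optimal solution of the proximal problem at y − (1/L)(g'(y) + e). Then there exists f_vec ∈ E with ‖f_vec‖ ≤ √(2ε/L) such that for every z ∈ E, f(x) ≤ ε + f(z) + L⟨x − y, z − x⟩ + (L/2)‖x − y‖² + ⟨e + L f_vec, z − x⟩. -/
open scoped RealInnerProductSpace
open Finset

noncomputable section

variable {E : Type*} [NormedAddCommGroup E] [InnerProductSpace ℝ E] [CompleteSpace E]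

/-- The ε-subdifferential of an `EReal`-valued function `a` at `x`:
the set of `y` such that `a t ≥ a x + ⟪y, t - x⟫ - ε` for all `t`. -/
def epsSubdiff (a : E → EReal) (ε : ℝ) (x : E) : Set E :=
  {y | ∀ t : E, a x + ((⟪y, t - x⟫ : ℝ) : EReal) - ((ε : ℝ) : EReal) ≤ a t}

/-- The objective function of the proximal problem at `y`. -/
def proxObj (L : ℝ) (h : E → EReal) (y x : E) : EReal :=
  ((L / 2 * ‖x - y‖ ^ 2 : ℝ) : EReal) + h x

/-- `x` is an `ε`-optimal solution of the proximal problem at `y`. -/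
def IsEpsOptimal (L : ℝ) (h : E → EReal) (ε : ℝ) (y x : E) : Prop :=
  proxObj L h y x ≤ ((ε : ℝ) : EReal) + ⨅ z : E, proxObj L h y z

/-- Convexity for `EReal`-valued functions. -/
def ERealConvexOn (h : E → EReal) : Prop :=
  ∀ x y : E, ∀ a b : ℝ, 0 ≤ a → 0 ≤ b → a + b = 1 →
    h (a • x + b • y) ≤ ((a : ℝ) : EReal) * h x + ((b : ℝ) : EReal) * h y

theorem hasDerivAt_comp_lineMap {g : E → ℝ} {g' : E → E} (hgrad : ∀ w, HasGradientAt g (g' w) w)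
    (y d : E) (t : ℝ) :
    HasDerivAt (fun t : ℝ => g (y + t • d)) ⟪g' (y + t • d), d⟫ t := by
  have hline : HasDerivAt (fun t : ℝ => y + t • d) d t := by
    simpa using ((hasDerivAt_id t).smul_const d).const_add y
  exact (hgrad (y + t • d)).hasFDerivAt.comp_hasDerivAt t hline

/-- A convex function lies above its tangent hyperplanes. -/
theorem ConvexOn.add_inner_gradient_le {g : E → ℝ} {g' : E → E} (hg : ConvexOn ℝ Set.univ g)
    (hgrad : ∀ w, HasGradientAt g (g' w) w) (y z : E) :
    g y + ⟪g' y, z - y⟫ ≤ g z := by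
  have hconv : ConvexOn ℝ Set.univ (fun t : ℝ => g (y + t • (z - y))) := by
    have := hg.comp_affineMap (AffineMap.lineMap y z : ℝ →ᵃ[ℝ] E)
    simpa [Function.comp_def, AffineMap.lineMap_apply, add_comm] using this
  have hderiv := hasDerivAt_comp_lineMap hgrad y (z - y) 0
  have hslope := hconv.le_slope_of_hasDerivAt (Set.mem_univ 0) (Set.mem_univ 1) one_pos hderiv
  simp [slope_def_field] at hslope
  linarith

/-- The descent lemma for functions with Lipschitz gradient. -/
theorem le_add_inner_gradient_add_sq {L : ℝ} {g : E → ℝ} {g' : E → E}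
    (hgrad : ∀ w, HasGradientAt g (g' w) w) (hlip : ∀ w w', ‖g' w - g' w'‖ ≤ L * ‖w - w'‖)
    (y x : E) :
    g x ≤ g y + ⟪g' y, x - y⟫ + L / 2 * ‖x - y‖ ^ 2 := by
  set d := x - y with hd
  let φ : ℝ → ℝ := fun t => g (y + t • d) - (t * ⟪g' y, d⟫ + L / 2 * ‖d‖ ^ 2 * t ^ 2)
  have hφ (t : ℝ) : HasDerivAt φ
      (⟪g' (y + t • d), d⟫ - (⟪g' y, d⟫ + L / 2 * ‖d‖ ^ 2 * (2 * t))) t := by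
    have h₁ := (hasDerivAt_id t).mul_const ⟪g' y, d⟫
    have h₂ := (hasDerivAt_pow 2 t).const_mul (L / 2 * ‖d‖ ^ 2)
    refine ((hasDerivAt_comp_lineMap hgrad y d t).sub (h₁.add h₂)).congr_deriv ?_
    simp
  have hanti : AntitoneOn φ (Set.Ici 0) := by
    refine antitoneOn_of_deriv_nonpos (convex_Ici 0)
      (fun t _ => (hφ t).continuousAt.continuousWithinAt)
      (fun t _ => (hφ t).differentiableAt.differentiableWithinAt) fun t ht => ?_
    rw [interior_Ici, Set.mem_Ioi] at ht
    rw [(hφ t).deriv]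
    have h₁ : ⟪g' (y + t • d) - g' y, d⟫ ≤ L * (t * ‖d‖) * ‖d‖ := by
      refine (real_inner_le_norm _ _).trans ?_
      gcongr
      simpa [norm_smul, abs_of_pos ht] using hlip (y + t • d) y
    rw [inner_sub_left] at h₁
    linarith
  have h₀₁ := hanti (Set.mem_Ici.2 le_rfl) (Set.mem_Ici.2 zero_le_one) zero_le_one
  simp only [φ, one_smul, zero_smul, add_zero, hd, add_sub_cancel] at h₀₁
  rw [← hd] at h₀₁
  linarith

omit [CompleteSpace E] in
theorem ERealConvexOn.le_coe_of_le_coe {h : E → EReal} (hh : ERealConvexOn h) {x y : E} {r s : ℝ}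
    (hx : h x ≤ r) (hy : h y ≤ s) {a b : ℝ} (ha : 0 ≤ a) (hb : 0 ≤ b) (hab : a + b = 1) :
    h (a • x + b • y) ≤ ((a * r + b * s : ℝ) : EReal) := by
  refine (hh x y a b ha hb hab).trans ?_
  push_cast
  exact add_le_add (mul_le_mul_of_nonneg_left hx (by exact_mod_cast ha))
    (mul_le_mul_of_nonneg_left hy (by exact_mod_cast hb))

/-- The proximal problem attains its infimum `m`. -/
theorem exists_prox_minimizer {L : ℝ} (hL : 0 < L) {h : E → EReal} (hconv : ERealConvexOn h)
    (hlsc : LowerSemicontinuous h) {u : E} {m : ℝ}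
    (hlower : ∀ (z : E) (r : ℝ), h z ≤ r → m ≤ L / 2 * ‖z - u‖ ^ 2 + r)
    (happrox : ∀ δ : ℝ, 0 < δ → ∃ z, h z ≤ ((m + δ - L / 2 * ‖z - u‖ ^ 2 : ℝ) : EReal)) :
    ∃ p, h p ≤ ((m - L / 2 * ‖p - u‖ ^ 2 : ℝ) : EReal) := by
  choose z hz using fun n : ℕ => happrox (1 / ((n : ℝ) + 1)) (by positivity)
  have hdist (n k : ℕ) : L / 4 * ‖z n - z k‖ ^ 2 ≤ 1 / ((n : ℝ) + 1) + 1 / ((k : ℝ) + 1) := by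
    have hmid := hlower _ _ (hconv.le_coe_of_le_coe (hz n) (hz k) (a := 1 / 2) (b := 1 / 2)
      (by norm_num) (by norm_num) (by norm_num))
    have hpar := parallelogram_law_with_norm ℝ (z n - u) (z k - u)
    have hsum : (1 / 2 : ℝ) • z n + (1 / 2 : ℝ) • z k - u
        = (1 / 2 : ℝ) • ((z n - u) + (z k - u)) := by module
    rw [hsum, norm_smul, Real.norm_of_nonneg (by norm_num), mul_pow] at hmid
    rw [sub_sub_sub_cancel_right] at hpar
    linear_combination 2 * hmid + L / 4 * hpar
  have hcauchy : CauchySeq z := by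
    refine Metric.cauchySeq_iff.2 fun η hη => ?_
    obtain ⟨N, hN⟩ := exists_nat_one_div_lt (show 0 < L / 8 * η ^ 2 by positivity)
    refine ⟨N, fun n hn k hk => ?_⟩
    rw [dist_eq_norm]
    refine lt_of_pow_lt_pow_left₀ 2 hη.le ?_
    have h₁ : 1 / ((n : ℝ) + 1) ≤ 1 / ((N : ℝ) + 1) := by gcongr
    have h₂ : 1 / ((k : ℝ) + 1) ≤ 1 / ((N : ℝ) + 1) := by gcongr
    have := hdist n k
    refine lt_of_mul_lt_mul_left (a := L / 4) ?_ (by positivity)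
    linarith
  obtain ⟨p, hp⟩ := cauchySeq_tendsto_of_complete hcauchy
  refine ⟨p, le_of_not_gt fun hlt => ?_⟩
  obtain ⟨r, hr, hrp⟩ := EReal.lt_iff_exists_real_btwn.1 hlt
  have hlim : Filter.Tendsto (fun n : ℕ => m + 1 / ((n : ℝ) + 1) - L / 2 * ‖z n - u‖ ^ 2)
      Filter.atTop (nhds (m + 0 - L / 2 * ‖p - u‖ ^ 2)) :=
    (tendsto_one_div_add_atTop_nhds_zero_nat.const_add m).sub
      (((hp.sub_const u).norm.pow 2).const_mul (L / 2))
  rw [add_zero] at hlim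
  obtain ⟨n, hn₁, hn₂⟩ := ((hp.eventually (hlsc p r hrp)).and
    (hlim.eventually_lt_const (EReal.coe_lt_coe_iff.1 hr))).exists
  exact absurd (hn₁.trans_le (hz n)) (not_lt.2 (EReal.coe_le_coe_iff.2 hn₂.le))

omit [CompleteSpace E] in
/-- The first-order optimality condition for the proximal problem. -/
theorem prox_minimizer_variational_inequality {L : ℝ} {h : E → EReal} (hconv : ERealConvexOn h)
    {u p : E} {m : ℝ} (hlower : ∀ (z : E) (r : ℝ), h z ≤ r → m ≤ L / 2 * ‖z - u‖ ^ 2 + r)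
    (hp : h p ≤ ((m - L / 2 * ‖p - u‖ ^ 2 : ℝ) : EReal)) {z : E} {r : ℝ} (hz : h z ≤ r) :
    m - L / 2 * ‖p - u‖ ^ 2 ≤ r + L * ⟪p - u, z - p⟫ := by
  set c := m - L / 2 * ‖p - u‖ ^ 2 with hc
  have hineq (t : ℝ) (ht : t ∈ Set.Ioo (0 : ℝ) 1) :
      c ≤ r + L * ⟪p - u, z - p⟫ + t * (L / 2 * ‖z - p‖ ^ 2) := by
    have hseg := hlower _ _ (hconv.le_coe_of_le_coe hp hz (sub_nonneg.2 ht.2.le) ht.1.le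
      (sub_add_cancel 1 t))
    have hsum : (1 - t) • p + t • z - u = (p - u) + t • (z - p) := by module
    rw [hsum, norm_add_sq_real, inner_smul_right, norm_smul, mul_pow, Real.norm_eq_abs, sq_abs]
      at hseg
    refine le_of_mul_le_mul_left ?_ ht.1
    linarith
  have hlim : Filter.Tendsto (fun t : ℝ => r + L * ⟪p - u, z - p⟫ + t * (L / 2 * ‖z - p‖ ^ 2))
      (nhdsWithin 0 (Set.Ioi 0)) (nhds (r + L * ⟪p - u, z - p⟫ + 0 * (L / 2 * ‖z - p‖ ^ 2))) :=
    Filter.Tendsto.mono_left (Continuous.tendsto (by fun_prop) 0) nhdsWithin_le_nhds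
  rw [zero_mul, add_zero] at hlim
  exact ge_of_tendsto hlim
    (Filter.mem_of_superset (Ioo_mem_nhdsGT one_pos) hineq)

omit [InnerProductSpace ℝ E] [CompleteSpace E] in
theorem coe_le_proxObj_iff {L : ℝ} {h : E → EReal} (hbot : ∀ w, h w ≠ ⊥) {u z : E} {m : ℝ} :
    (m : EReal) ≤ proxObj L h u z ↔ ∀ r : ℝ, h z ≤ r → m ≤ L / 2 * ‖z - u‖ ^ 2 + r := by
  unfold proxObj
  induction hz : h z with
  | bot => exact absurd hz (hbot z)
  | top => simp [-EReal.coe_mul, -EReal.coe_pow]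
  | coe s =>
    norm_cast
    exact ⟨fun hm r hr => hm.trans (by gcongr), fun hm => hm s le_rfl⟩

omit [InnerProductSpace ℝ E] [CompleteSpace E] in
theorem le_coe_sub_of_proxObj_le {L : ℝ} {h : E → EReal} (hbot : ∀ w, h w ≠ ⊥) {u z : E} {r : ℝ}
    (hz : proxObj L h u z ≤ r) : h z ≤ ((r - L / 2 * ‖z - u‖ ^ 2 : ℝ) : EReal) := by
  unfold proxObj at hz
  induction hs : h z with
  | bot => exact absurd hs (hbot z)
  | top =>
    rw [hs, EReal.coe_add_top, top_le_iff] at hz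
    exact absurd hz (EReal.coe_ne_top r)
  | coe s =>
    rw [hs] at hz
    norm_cast at hz ⊢
    linarith

omit [InnerProductSpace ℝ E] [CompleteSpace E] in
/-- An `ε`-optimal point forces the infimum of a proper proximal problem to be finite. -/
theorem IsEpsOptimal.exists_iInf_eq_coe {L : ℝ} {h : E → EReal} {ε : ℝ} {u x : E}
    (hproper : ∃ w, h w ≠ ⊤) (hbot : ∀ w, h w ≠ ⊥) (hopt : IsEpsOptimal L h ε u x) :
    ∃ m : ℝ, ⨅ z : E, proxObj L h u z = (m : EReal) := by
  unfold IsEpsOptimal at hopt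
  induction hm : ⨅ z : E, proxObj L h u z with
  | bot =>
    rw [hm, EReal.add_bot, le_bot_iff, proxObj, EReal.add_eq_bot_iff] at hopt
    exact absurd hopt (not_or_intro (EReal.coe_ne_bot _) (hbot x))
  | top =>
    obtain ⟨w, hw⟩ := hproper
    have htop := iInf_eq_top.1 hm w
    lift h w to ℝ using ⟨hw, hbot w⟩ with s hs
    rw [proxObj, ← hs, ← EReal.coe_add] at htop
    exact absurd htop (EReal.coe_ne_top _)
  | coe m => exact ⟨m, rfl⟩

/-- An `ε`-optimal solution `x` of the proximal problem at `u` admits a vector `v`, of norm at most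
`√(2ε/L)`, such that `-L (x - u + v)` is an `ε`-subgradient of `h` at `x`. -/
theorem IsEpsOptimal.exists_norm_le_forall_le {L : ℝ} (hL : 0 < L) {h : E → EReal}
    (hconv : ERealConvexOn h) (hlsc : LowerSemicontinuous h) (hproper : ∃ w, h w ≠ ⊤)
    (hbot : ∀ w, h w ≠ ⊥) {ε : ℝ} {u x : E} (hopt : IsEpsOptimal L h ε u x) :
    ∃ v : E, ‖v‖ ≤ Real.sqrt (2 * ε / L) ∧ ∀ (z : E) (r : ℝ), h z ≤ r →
      h x ≤ ((ε + r + L * ⟪x - u + v, z - x⟫ : ℝ) : EReal) := by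
  obtain ⟨m, hm⟩ := hopt.exists_iInf_eq_coe hproper hbot
  have hlower (z : E) : ∀ r : ℝ, h z ≤ r → m ≤ L / 2 * ‖z - u‖ ^ 2 + r :=
    (coe_le_proxObj_iff hbot).1 (hm ▸ iInf_le _ z)
  obtain ⟨p, hp⟩ := exists_prox_minimizer hL hconv hlsc hlower fun δ hδ => by
    have hlt : ⨅ z : E, proxObj L h u z < ((m + δ : ℝ) : EReal) := by
      rw [hm]
      exact_mod_cast lt_add_of_pos_right m hδ
    obtain ⟨z, hz⟩ := iInf_lt_iff.1 hlt
    exact ⟨z, le_coe_sub_of_proxObj_le hbot hz.le⟩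
  have hx : h x ≤ ((ε + m - L / 2 * ‖x - u‖ ^ 2 : ℝ) : EReal) := by
    refine le_coe_sub_of_proxObj_le hbot ?_
    rw [IsEpsOptimal, hm] at hopt
    exact_mod_cast hopt
  have hexpand : ‖x - u‖ ^ 2 = ‖p - u‖ ^ 2 + 2 * ⟪p - u, x - p⟫ + ‖x - p‖ ^ 2 := by
    rw [← norm_add_sq_real, add_comm, sub_add_sub_cancel]
  refine ⟨p - x, ?_, fun z r hz => hx.trans (EReal.coe_le_coe_iff.2 ?_)⟩
  · have := prox_minimizer_variational_inequality hconv hlower hp hx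
    rw [norm_sub_rev]
    refine Real.le_sqrt_of_sq_le ?_
    rw [le_div_iff₀ hL]
    linear_combination 2 * this - L * hexpand
  · have hvar := prox_minimizer_variational_inequality hconv hlower hp hz
    have hsplit : ⟪x - u + (p - x), z - x⟫ = ⟪p - u, z - p⟫ - ⟪p - u, x - p⟫ := by
      rw [← inner_sub_right, sub_sub_sub_cancel_right, add_comm, sub_add_sub_cancel]
    rw [hsplit]
    have hnonneg : 0 ≤ L / 2 * ‖x - p‖ ^ 2 := by positivity
    linear_combination hvar + hnonneg - L / 2 * hexpand

theorem stmt_7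
    (L : ℝ) (hL : 0 < L)
    (g : E → ℝ) (g' : E → E)
    (hgconv : ConvexOn ℝ Set.univ g)
    (hgrad : ∀ w, HasGradientAt g (g' w) w)
    (hlip : ∀ w w', ‖g' w - g' w'‖ ≤ L * ‖w - w'‖)
    (h : E → EReal)
    (hhconv : ERealConvexOn h)
    (hhlsc : LowerSemicontinuous h)
    (hhproper : ∃ w, h w ≠ ⊤) (hhnbot : ∀ w, h w ≠ ⊥)
    (f : E → EReal) (hf : ∀ w, f w = ((g w : ℝ) : EReal) + h w)
    (y e : E) (ε : ℝ) (hε : 0 ≤ ε) (xx : E)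
    (hopt : IsEpsOptimal L h ε (y - (1 / L) • (g' y + e)) xx) :
    ∃ fvec : E, ‖fvec‖ ≤ Real.sqrt (2 * ε / L) ∧ ∀ z : E,
      f xx ≤ f z + ((ε + L * ⟪xx - y, z - xx⟫ + L / 2 * ‖xx - y‖ ^ 2 +
        ⟪e + L • fvec, z - xx⟫ : ℝ) : EReal) := by
  obtain ⟨v, hv, hsub⟩ := hopt.exists_norm_le_forall_le hL hhconv hhlsc hhproper hhnbot
  refine ⟨v, hv, fun z => ?_⟩
  rw [hf, hf]
  induction hz : h z with
  | bot => exact absurd hz (hhnbot z)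
  | top => simp only [EReal.coe_add_top, EReal.top_add_coe, le_top]
  | coe r =>
    refine (add_le_add_right (hsub z r hz.le) _).trans ?_
    norm_cast
    have hdescent := le_add_inner_gradient_add_sq hgrad hlip y xx
    have htangent := hgconv.add_inner_gradient_le hgrad y z
    have hsplit : ⟪g' y, z - y⟫ = ⟪g' y, z - xx⟫ + ⟪g' y, xx - y⟫ := by
      rw [← inner_add_right, sub_add_sub_cancel]
    have hcombine : L * ⟪xx - (y - (1 / L) • (g' y + e)) + v, z - xx⟫ =
        L * ⟪xx - y, z - xx⟫ + ⟪g' y, z - xx⟫ + ⟪e + L • v, z - xx⟫ := by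
      simp only [← real_inner_smul_left, ← inner_add_left]
      congr 1
      match_scalars <;> field_simp
    linarith
end
end

section
/- Assume g is μ-strongly convex with 0 < μ < L and set γ = μ/L. Consider the basic inexact proximal-gradient method (y_k = x_k): for each k ≥ 1, x_k is an ε_k-optimal solution of the proximal problem at x_{k-1} − (1/L)(g'(x_{k-1}) + e_k). Suppose there exist C' ≥ 0 and Q' with 0 ≤ Q' < 1 − γ such that ‖e_k‖/L + √(2ε_k/L) ≤ C' (Q')^k for all k ≥ 1. Then for all k ≥ 1, ‖x_k − x*‖ ≤ (1 − γ)^k ( ‖x_0 − x*‖ + C' Q' / (1 − γ − Q') ); in particular ‖x_k − x*‖ converges to 0 linearly with rate (1 − γ). -/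
open scoped RealInnerProductSpace
open Finset

noncomputable section

variable {E : Type*} [NormedAddCommGroup E] [InnerProductSpace ℝ E] [CompleteSpace E]

/-- Descent lemma: a function with `L`-Lipschitz gradient lies below its quadratic upper model. -/
theorem le_add_inner_add_of_lipschitz_gradient {L : ℝ} {g : E → ℝ} {g' : E → E}
    (hgrad : ∀ w, HasGradientAt g (g' w) w)
    (hlip : ∀ w w', ‖g' w - g' w'‖ ≤ L * ‖w - w'‖) (w d : E) :
    g (w + d) ≤ g w + ⟪g' w, d⟫ + L / 2 * ‖d‖ ^ 2 := by
  have hderiv : ∀ t : ℝ, HasDerivAt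
      (fun s : ℝ => g (w + s • d) - s * ⟪g' w, d⟫ - L / 2 * s ^ 2 * ‖d‖ ^ 2)
      (⟪g' (w + t • d), d⟫ - ⟪g' w, d⟫ - L * t * ‖d‖ ^ 2) t := by
    intro t
    have hline : HasDerivAt (fun s : ℝ => w + s • d) d t := by
      simpa using ((hasDerivAt_id t).smul_const d).const_add w
    have hg : HasDerivAt (fun s : ℝ => g (w + s • d)) ⟪g' (w + t • d), d⟫ t := by
      have hcomp := (hgrad (w + t • d)).hasFDerivAt.comp_hasDerivAt t hline
      rwa [InnerProductSpace.toDual_apply_apply] at hcomp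
    have hlin : HasDerivAt (fun s : ℝ => s * ⟪g' w, d⟫) ⟪g' w, d⟫ t := by
      simpa using (hasDerivAt_id t).mul_const ⟪g' w, d⟫
    have hsq : HasDerivAt (fun s : ℝ => L / 2 * s ^ 2 * ‖d‖ ^ 2) (L * t * ‖d‖ ^ 2) t := by
      have hpow := ((hasDerivAt_pow 2 t).const_mul (L / 2)).mul_const (‖d‖ ^ 2)
      refine hpow.congr_deriv ?_
      push_cast
      ring
    exact (hg.sub hlin).sub hsq
  have hanti : AntitoneOn
      (fun s : ℝ => g (w + s • d) - s * ⟪g' w, d⟫ - L / 2 * s ^ 2 * ‖d‖ ^ 2) (Set.Ici 0) := by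
    refine antitoneOn_of_deriv_nonpos (convex_Ici 0)
      (fun t _ => (hderiv t).continuousAt.continuousWithinAt)
      (fun t _ => (hderiv t).differentiableAt.differentiableWithinAt) fun t ht => ?_
    rw [interior_Ici, Set.mem_Ioi] at ht
    have hbound : ‖g' (w + t • d) - g' w‖ ≤ L * (t * ‖d‖) := by
      simpa [norm_smul, abs_of_pos ht] using hlip (w + t • d) w
    have hcs := real_inner_le_norm (g' (w + t • d) - g' w) d
    rw [inner_sub_left] at hcs
    rw [(hderiv t).deriv]
    nlinarith [mul_le_mul_of_nonneg_right hbound (norm_nonneg d)]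
  have hle := hanti (Set.mem_Ici.2 le_rfl) (Set.mem_Ici.2 zero_le_one) zero_le_one
  simp only [one_smul, zero_smul, add_zero] at hle
  linarith

omit [CompleteSpace E] in
/-- A function between its affine lower models and its quadratic upper models has a cocoercive
gradient. -/
theorem norm_sq_le_inner_of_convex_of_smooth {M : ℝ} (hM : 0 < M) {φ : E → ℝ} {φ' : E → E}
    (hconv : ∀ w w', φ w + ⟪φ' w, w' - w⟫ ≤ φ w')
    (hsmooth : ∀ w d, φ (w + d) ≤ φ w + ⟪φ' w, d⟫ + M / 2 * ‖d‖ ^ 2) (w w' : E) :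
    ‖φ' w - φ' w'‖ ^ 2 ≤ M * ⟪φ' w - φ' w', w - w'⟫ := by
  have key : ∀ u v : E,
      φ u + ⟪φ' u, v - u⟫ + 1 / (2 * M) * ‖φ' v - φ' u‖ ^ 2 ≤ φ v := by
    intro u v
    have hlow := hconv u (v + (-(1 / M)) • (φ' v - φ' u))
    have hup := hsmooth v ((-(1 / M)) • (φ' v - φ' u))
    rw [show v + (-(1 / M)) • (φ' v - φ' u) - u = (v - u) + (-(1 / M)) • (φ' v - φ' u) by abel,
      inner_add_right, real_inner_smul_right] at hlow
    rw [real_inner_smul_right, norm_smul, mul_pow, Real.norm_eq_abs, sq_abs] at hup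
    have hsplit : ⟪φ' v, φ' v - φ' u⟫ - ⟪φ' u, φ' v - φ' u⟫ = ‖φ' v - φ' u‖ ^ 2 := by
      rw [← inner_sub_left, real_inner_self_eq_norm_sq]
    have hcoef : M / 2 * ((-(1 / M)) ^ 2 * ‖φ' v - φ' u‖ ^ 2)
        = 1 / (2 * M) * ‖φ' v - φ' u‖ ^ 2 := by field_simp
    have hscaled : 1 / M * ⟪φ' v, φ' v - φ' u⟫ - 1 / M * ⟪φ' u, φ' v - φ' u⟫
        = 2 * (1 / (2 * M) * ‖φ' v - φ' u‖ ^ 2) := by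
      rw [← mul_sub, hsplit]; field_simp
    linarith
  have h1 := key w w'
  have h2 := key w' w
  have hinner : ⟪φ' w - φ' w', w - w'⟫ = -⟪φ' w, w' - w⟫ - ⟪φ' w', w - w'⟫ := by
    rw [inner_sub_left, ← neg_sub w w', inner_neg_right, neg_neg]
  rw [norm_sub_rev (φ' w') (φ' w)] at h1
  have hsum : 2 * (1 / (2 * M) * ‖φ' w - φ' w'‖ ^ 2) ≤ ⟪φ' w - φ' w', w - w'⟫ := by
    linarith
  have hmul := mul_le_mul_of_nonneg_left hsum hM.le
  calc ‖φ' w - φ' w'‖ ^ 2 = M * (2 * (1 / (2 * M) * ‖φ' w - φ' w'‖ ^ 2)) := by field_simp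
    _ ≤ _ := hmul

/-- The gradient step of length `1 / L` on a `μ`-strongly convex, `L`-smooth function is a
contraction with factor `1 - μ / L`. -/
theorem norm_gradient_step_sub_le {L μ : ℝ} (hμ : 0 < μ) (hμL : μ < L) {g : E → ℝ} {g' : E → E}
    (hgrad : ∀ w, HasGradientAt g (g' w) w)
    (hlip : ∀ w w', ‖g' w - g' w'‖ ≤ L * ‖w - w'‖)
    (hsc : ∀ w w', g w + ⟪g' w, w' - w⟫ + μ / 2 * ‖w' - w‖ ^ 2 ≤ g w') (w w' : E) :
    ‖(w - w') - (1 / L) • (g' w - g' w')‖ ≤ (1 - μ / L) * ‖w - w'‖ := by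
  have hL : 0 < L := hμ.trans hμL
  have hM : 0 < L - μ := sub_pos.2 hμL
  have hco := norm_sq_le_inner_of_convex_of_smooth hM
    (φ := fun u => g u - μ / 2 * ‖u‖ ^ 2) (φ' := fun u => g' u - μ • u)
    (by
      intro u v
      have h1 := hsc u v
      have h2 := norm_sub_sq_real v u
      rw [inner_sub_left, real_inner_smul_left, inner_sub_right u,
        real_inner_self_eq_norm_sq, real_inner_comm v u]
      rw [h2] at h1
      linarith)
    (by
      intro u d
      have h1 := le_add_inner_add_of_lipschitz_gradient hgrad hlip u d
      have h2 := norm_add_sq_real u d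
      rw [inner_sub_left, real_inner_smul_left, h2]
      linarith) w w'
  set d := w - w' with hd
  set D := g' w - μ • w - (g' w' - μ • w') with hD
  have hstep : d - (1 / L) • (g' w - g' w') = (1 - μ / L) • d - (1 / L) • D := by
    have hgD : g' w - g' w' = D + μ • d := by rw [hD, hd, smul_sub]; abel
    rw [hgD, smul_add, smul_smul, sub_smul, one_smul, one_div_mul_eq_div]
    abel
  have hγ : 0 ≤ 1 - μ / L := by
    rw [sub_nonneg, div_le_one hL]; exact hμL.le
  rw [hstep]
  refine abs_le_of_sq_le_sq' ?_ (by positivity) |>.2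
  rw [norm_sub_sq_real, norm_smul, norm_smul, real_inner_smul_left, real_inner_smul_right,
    Real.norm_eq_abs, Real.norm_eq_abs, mul_pow, mul_pow, sq_abs, sq_abs, real_inner_comm,
    mul_pow]
  have hcross : (1 - μ / L) * (1 / L * ⟪D, d⟫) = (1 / L) ^ 2 * ((L - μ) * ⟪D, d⟫) := by
    field_simp
  rw [hcross]
  have := mul_le_mul_of_nonneg_left hco (sq_nonneg (1 / L))
  have : 0 ≤ (1 / L) ^ 2 * ‖D‖ ^ 2 := by positivity
  linarith

omit [CompleteSpace E] in
theorem ERealConvexOn.lineMap_le {h : E → EReal} (hconv : ERealConvexOn h) {u v : E} {a b s : ℝ}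
    (hu : h u = a) (hv : h v = b) (hs0 : 0 ≤ s) (hs1 : s ≤ 1) :
    h (u + s • (v - u)) ≤ (((1 - s) * a + s * b : ℝ) : EReal) := by
  have hle := hconv u v (1 - s) s (by linarith) hs0 (by ring)
  rw [hu, hv, show (1 - s) • u + s • v = u + s • (v - u) by
    rw [sub_smul, one_smul, smul_sub]; abel] at hle
  exact_mod_cast hle

/-- First-order optimality of a minimizer of the composite objective `g + h`. -/
theorem le_add_inner_of_isMin_add {L : ℝ} {g : E → ℝ} {g' : E → E}
    (hgrad : ∀ w, HasGradientAt g (g' w) w)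
    (hlip : ∀ w w', ‖g' w - g' w'‖ ≤ L * ‖w - w'‖) {h : E → EReal}
    (hconv : ERealConvexOn h) {p : E}
    (hmin : ∀ w, (g p : EReal) + h p ≤ (g w : EReal) + h w) {t : E} {a b : ℝ}
    (hp : h p = a) (ht : h t = b) : a ≤ b + ⟪g' p, t - p⟫ := by
  have key : ∀ s : ℝ, 0 < s → s ≤ 1 →
      a ≤ b + ⟪g' p, t - p⟫ + s * (L / 2 * ‖t - p‖ ^ 2) := by
    intro s hs0 hs1
    have hseg := hmin (p + s • (t - p))
    have hle : (g p : EReal) + a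
        ≤ (g (p + s • (t - p)) : EReal) + (((1 - s) * a + s * b : ℝ) : EReal) := by
      rw [← hp]
      exact hseg.trans (add_le_add le_rfl (hconv.lineMap_le hp ht hs0.le hs1))
    have hreal : g p + a ≤ g (p + s • (t - p)) + ((1 - s) * a + s * b) := by
      exact_mod_cast hle
    have hdesc := le_add_inner_add_of_lipschitz_gradient hgrad hlip p (s • (t - p))
    rw [real_inner_smul_right, norm_smul, mul_pow, Real.norm_eq_abs, sq_abs] at hdesc
    refine le_of_mul_le_mul_left ?_ hs0
    linarith
  have hlim : Filter.Tendsto (fun s : ℝ => b + ⟪g' p, t - p⟫ + s * (L / 2 * ‖t - p‖ ^ 2))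
      (nhdsWithin 0 (Set.Ioi 0)) (nhds (b + ⟪g' p, t - p⟫)) := by
    have hcont : Continuous fun s : ℝ => b + ⟪g' p, t - p⟫ + s * (L / 2 * ‖t - p‖ ^ 2) := by
      fun_prop
    simpa using (hcont.tendsto 0).mono_left nhdsWithin_le_nhds
  refine ge_of_tendsto hlim ?_
  filter_upwards [Ioc_mem_nhdsGT (zero_lt_one' ℝ)] with s hs using key s hs.1 hs.2

omit [InnerProductSpace ℝ E] [CompleteSpace E] in
theorem IsEpsOptimal.proxObj_le {L ε : ℝ} {h : E → EReal} {y u : E}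
    (hu : IsEpsOptimal L h ε y u) (z : E) :
    proxObj L h y u ≤ (ε : EReal) + proxObj L h y z :=
  hu.trans (add_le_add le_rfl (iInf_le _ z))

omit [CompleteSpace E] in
/-- If `L • (q - p)` is a subgradient of `h` at `p`, so that `p` is the exact proximal point of
`q`, then an `ε`-optimal proximal point `u` of `y` is within `‖y - q‖ + √(2ε/L)` of `p`. -/
theorem IsEpsOptimal.norm_sub_le {L ε : ℝ} (hL : 0 < L) {h : E → EReal}
    (hconv : ERealConvexOn h) (hbot : ∀ w, h w ≠ ⊥) {y u p q : E} {a : ℝ} (hp : h p = a)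
    (hsub : ∀ (t : E) (b : ℝ), h t = b → a + L * ⟪q - p, t - p⟫ ≤ b)
    (hu : IsEpsOptimal L h ε y u) :
    ‖u - p‖ ≤ ‖y - q‖ + √(2 * ε / L) := by
  have hutop : h u ≠ ⊤ := by
    intro htop
    have hle := hu.proxObj_le p
    rw [proxObj, proxObj, htop, hp, EReal.coe_add_top, top_le_iff] at hle
    exact EReal.coe_ne_top (ε + (L / 2 * ‖p - y‖ ^ 2 + a)) (by exact_mod_cast hle)
  obtain ⟨b, hb⟩ : ∃ b : ℝ, h u = b := ⟨_, (EReal.coe_toReal hutop (hbot u)).symm⟩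
  have key : ∀ s : ℝ, 0 ≤ s → s ≤ 1 →
      s * (L * (‖u - p‖ ^ 2 - ⟪y - q, u - p⟫)) ≤ ε + L / 2 * (s ^ 2 * ‖u - p‖ ^ 2) := by
    intro s hs0 hs1
    have hle : ((L / 2 * ‖u - y‖ ^ 2 : ℝ) : EReal) + b ≤ (ε : EReal) +
        (((L / 2 * ‖u + s • (p - u) - y‖ ^ 2 : ℝ) : EReal)
          + (((1 - s) * b + s * a : ℝ) : EReal)) := by
      rw [← hb]
      exact (hu.proxObj_le _).trans
        (add_le_add le_rfl (add_le_add le_rfl (hconv.lineMap_le hb hp hs0 hs1)))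
    have hreal : L / 2 * ‖u - y‖ ^ 2 + b ≤ ε +
        (L / 2 * ‖u + s • (p - u) - y‖ ^ 2 + ((1 - s) * b + s * a)) := by
      exact_mod_cast hle
    have hnorm : ‖u + s • (p - u) - y‖ ^ 2
        = ‖u - y‖ ^ 2 - 2 * (s * ⟪u - y, u - p⟫) + s ^ 2 * ‖u - p‖ ^ 2 := by
      rw [show u + s • (p - u) - y = (u - y) - s • (u - p) by
        rw [← neg_sub u p, smul_neg]; abel, norm_sub_sq_real, real_inner_smul_right, norm_smul,
        mul_pow, Real.norm_eq_abs, sq_abs]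
    have hinner : ⟪u - y, u - p⟫ + ⟪q - p, u - p⟫ = ‖u - p‖ ^ 2 - ⟪y - q, u - p⟫ := by
      rw [← real_inner_self_eq_norm_sq, ← inner_add_left, ← inner_sub_left]
      congr 1
      abel
    have hsubs := mul_le_mul_of_nonneg_left (hsub u b hb) hs0
    rw [← hinner]
    rw [hnorm] at hreal
    linarith
  rcases le_or_gt ‖u - p‖ ‖y - q‖ with hle | hlt
  · exact hle.trans (le_add_of_nonneg_right (Real.sqrt_nonneg _))
  rw [← sub_le_iff_le_add']
  refine Real.le_sqrt_of_sq_le ?_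
  have hr : 0 < ‖u - p‖ := (norm_nonneg _).trans_lt hlt
  have hs := key ((‖u - p‖ - ‖y - q‖) / ‖u - p‖) (div_nonneg (sub_nonneg.2 hlt.le) hr.le)
    ((div_le_one hr).2 (sub_le_self _ (norm_nonneg _)))
  have hcs := real_inner_le_norm (y - q) (u - p)
  have hlow : (‖u - p‖ - ‖y - q‖) / ‖u - p‖ * (L * (‖u - p‖ * (‖u - p‖ - ‖y - q‖)))
      ≤ (‖u - p‖ - ‖y - q‖) / ‖u - p‖ * (L * (‖u - p‖ ^ 2 - ⟪y - q, u - p⟫)) := by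
    have := sub_nonneg.2 hlt.le
    gcongr
    linarith
  have hlhs : (‖u - p‖ - ‖y - q‖) / ‖u - p‖ * (L * (‖u - p‖ * (‖u - p‖ - ‖y - q‖)))
      = L * (‖u - p‖ - ‖y - q‖) ^ 2 := by field_simp
  rw [← mul_pow, div_mul_cancel₀ _ hr.ne'] at hs
  rw [le_div_iff₀ hL]
  linarith

/-- A linear recursion perturbed by a geometric error with smaller ratio. -/
theorem le_pow_mul_of_le_mul_add_pow {r : ℕ → ℝ} {q C Q : ℝ} (hq : 0 ≤ q) (hC : 0 ≤ C)
    (hQ : 0 ≤ Q) (hQq : Q < q) (hr : ∀ k, r (k + 1) ≤ q * r k + C * Q ^ (k + 1)) (k : ℕ) :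
    r k ≤ q ^ k * (r 0 + C * Q / (q - Q)) := by
  have hpos : 0 < q - Q := sub_pos.2 hQq
  have hsharp : r k ≤ q ^ k * (r 0 + C * Q / (q - Q)) - C * Q ^ (k + 1) / (q - Q) := by
    induction k with
    | zero => simp
    | succ k ih =>
      refine (hr k).trans ((add_le_add (mul_le_mul_of_nonneg_left ih hq) le_rfl).trans_eq ?_)
      field_simp
      ring
  exact hsharp.trans (sub_le_self _ (by positivity))

theorem stmt_15
    (L μ : ℝ) (hμ : 0 < μ) (hμL : μ < L)
    (g : E → ℝ) (g' : E → E)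
    (hgrad : ∀ w, HasGradientAt g (g' w) w)
    (hlip : ∀ w w', ‖g' w - g' w'‖ ≤ L * ‖w - w'‖)
    (hsc : ∀ w w', g w + ⟪g' w, w' - w⟫ + μ / 2 * ‖w' - w‖ ^ 2 ≤ g w')
    (h : E → EReal)
    (hhconv : ERealConvexOn h)
    (hhlsc : LowerSemicontinuous h)
    (hhproper : ∃ w, h w ≠ ⊤) (hhnbot : ∀ w, h w ≠ ⊥)
    (f : E → EReal) (hf : ∀ w, f w = ((g w : ℝ) : EReal) + h w)
    (xstar : E) (hmin : ∀ w, f xstar ≤ f w)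
    (γ : ℝ) (hγ : γ = μ / L)
    (x e : ℕ → E) (ε : ℕ → ℝ) (hεnn : ∀ k, 0 ≤ ε k)
    (hstep : ∀ k, 1 ≤ k →
      IsEpsOptimal L h (ε k) (x (k - 1) - (1 / L) • (g' (x (k - 1)) + e k)) (x k))
    (C' Q' : ℝ) (hC' : 0 ≤ C') (hQ'nn : 0 ≤ Q') (hQ' : Q' < 1 - γ)
    (hdecay : ∀ k, 1 ≤ k → ‖e k‖ / L + Real.sqrt (2 * ε k / L) ≤ C' * Q' ^ k) :
    ∀ k, 1 ≤ k →
      ‖x k - xstar‖ ≤ (1 - γ) ^ k * (‖x 0 - xstar‖ + C' * Q' / (1 - γ - Q')) := by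
  have hL : 0 < L := hμ.trans hμL
  have hmin' : ∀ w, (g xstar : EReal) + h xstar ≤ (g w : EReal) + h w := fun w => by
    simpa only [hf] using hmin w
  have htop : h xstar ≠ ⊤ := by
    obtain ⟨w, hw⟩ := hhproper
    intro hx
    have hle := hmin' w
    rw [hx, EReal.coe_add_top, top_le_iff] at hle
    exact EReal.add_ne_top (EReal.coe_ne_top _) hw hle
  obtain ⟨a, ha⟩ : ∃ a : ℝ, h xstar = a := ⟨_, (EReal.coe_toReal htop (hhnbot _)).symm⟩
  have hsub : ∀ (t : E) (b : ℝ), h t = b →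
      a + L * ⟪xstar - (1 / L) • g' xstar - xstar, t - xstar⟫ ≤ b := by
    intro t b hb
    have hopt := le_add_inner_of_isMin_add hgrad hlip hhconv hmin' ha hb
    rw [sub_sub_cancel_left, inner_neg_left, real_inner_smul_left, mul_neg, ← mul_assoc,
      mul_one_div_cancel hL.ne', one_mul]
    linarith
  have hrec : ∀ k, ‖x (k + 1) - xstar‖ ≤ (1 - γ) * ‖x k - xstar‖ + C' * Q' ^ (k + 1) := by
    intro k
    have hprox := (hstep (k + 1) k.succ_pos).norm_sub_le hL hhconv hhnbot ha hsub
    have hcontr := norm_gradient_step_sub_le hμ hμL hgrad hlip hsc (x k) xstar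
    have herr := hdecay (k + 1) k.succ_pos
    rw [Nat.add_sub_cancel, show x k - (1 / L) • (g' (x k) + e (k + 1))
        - (xstar - (1 / L) • g' xstar)
        = ((x k - xstar) - (1 / L) • (g' (x k) - g' xstar)) - (1 / L) • e (k + 1) by
      rw [smul_add, smul_sub]; abel] at hprox
    have htri := norm_sub_le ((x k - xstar) - (1 / L) • (g' (x k) - g' xstar))
      ((1 / L) • e (k + 1))
    rw [norm_smul, Real.norm_of_nonneg (one_div_pos.2 hL).le, one_div_mul_eq_div] at htri
    rw [hγ]
    linarith
  exact fun k _ => le_pow_mul_of_le_mul_add_pow (r := fun k => ‖x k - xstar‖)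
    (hQ'nn.trans hQ'.le) hC' hQ'nn hQ' hrec k
end
end
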